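/- arXiv:1601.04276 — 2 statements merged into one kernel-verified Lean document; each statement's English description precedes it below -/
import Mathlib

section
/- Fix finite nonempty sets 𝒳, 𝒵, a pmf P_X on 𝒳, and a channel W from 𝒳 to 𝒵. Define E_s^iid(P_X,W,R) := min over joint pmfs Q on 𝒳×𝒵 with Q ≪ P_X×W of { D(Q‖P_X×W) + max(R − f(Q‖P_X×W), 0) }, and F_0(P_X,W,λ) := ln Σ_{(x,z): P_X(x)W(z|x)>0} P_X(x) W(z|x)^{1+λ} (P_X∘W)(z)^{−λ}. Then for every real R, E_s^iid(P_X,W,R) = max_{λ ∈ [0,1]} { λR − F_0(P_X,W,λ) }. -/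
open Filter

noncomputable section

/-- A probability mass function on a finite alphabet. -/
def IsPMF {α : Type*} [Fintype α] (p : α → ℝ) : Prop :=
  (∀ a, 0 ≤ p a) ∧ ∑ a, p a = 1

/-- A channel from `𝒳` to `𝒵`: each input is mapped to a pmf on `𝒵`. -/
def IsChannel {𝒳 𝒵 : Type*} [Fintype 𝒵] (W : 𝒳 → 𝒵 → ℝ) : Prop :=
  ∀ x, IsPMF (W x)

/-- Absolute continuity: `Q a > 0` implies `Q' a > 0`. -/
def AbsCont {α : Type*} (Q Q' : α → ℝ) : Prop :=
  ∀ a, 0 < Q a → 0 < Q' a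

/-- Kullback–Leibler divergence `D(Q‖Q')` (the sum over the support of `Q`). -/
def klDiv {α : Type*} [Fintype α] (Q Q' : α → ℝ) : ℝ :=
  ∑ a, if 0 < Q a then Q a * Real.log (Q a / Q' a) else 0

/-- `x`-marginal of a joint distribution. -/
def margX {𝒳 𝒵 : Type*} [Fintype 𝒵] (Q : 𝒳 × 𝒵 → ℝ) : 𝒳 → ℝ :=
  fun x => ∑ z, Q (x, z)

/-- `z`-marginal of a joint distribution. -/
def margZ {𝒳 𝒵 : Type*} [Fintype 𝒳] (Q : 𝒳 × 𝒵 → ℝ) : 𝒵 → ℝ :=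
  fun z => ∑ x, Q (x, z)

/-- The joint pmf `(x,z) ↦ P(x) W(z|x)`. -/
def jointPW {𝒳 𝒵 : Type*} (P : 𝒳 → ℝ) (W : 𝒳 → 𝒵 → ℝ) : 𝒳 × 𝒵 → ℝ :=
  fun p => P p.1 * W p.1 p.2

/-- The function `f(Q‖Q') = Σ_{Q(x,z)>0} Q(x,z) ln( Q'(x,z) / (Q'_X(x) Q'_Z(z)) )`. -/
def fFun {𝒳 𝒵 : Type*} [Fintype 𝒳] [Fintype 𝒵] (Q Q' : 𝒳 × 𝒵 → ℝ) : ℝ :=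
  ∑ p, if 0 < Q p then Q p * Real.log (Q' p / (margX Q' p.1 * margZ Q' p.2)) else 0

/-- The output distribution `(P∘W)(z) = Σ_x P(x)W(z|x)`. -/
def outDist {𝒳 𝒵 : Type*} [Fintype 𝒳] (P : 𝒳 → ℝ) (W : 𝒳 → 𝒵 → ℝ) : 𝒵 → ℝ :=
  fun z => ∑ x, P x * W x z

/-- `F₀(P_X,W,λ) = ln Σ_{(x,z): P_X(x)W(z|x)>0} P_X(x) W(z|x)^{1+λ} (P_X∘W)(z)^{−λ}`. -/
def F0 {𝒳 𝒵 : Type*} [Fintype 𝒳] [Fintype 𝒵] (P : 𝒳 → ℝ) (W : 𝒳 → 𝒵 → ℝ) (lam : ℝ) : ℝ :=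
  Real.log (∑ p : 𝒳 × 𝒵, if 0 < P p.1 * W p.1 p.2 then
    P p.1 * (W p.1 p.2) ^ (1 + lam) * (outDist P W p.2) ^ (-lam) else 0)

/-- The exact i.i.d. secrecy/resolvability exponent. -/
def EsIID {𝒳 𝒵 : Type*} [Fintype 𝒳] [Fintype 𝒵] (P : 𝒳 → ℝ) (W : 𝒳 → 𝒵 → ℝ) (R : ℝ) : ℝ :=
  sInf { e : ℝ | ∃ Q : 𝒳 × 𝒵 → ℝ, IsPMF Q ∧ AbsCont Q (jointPW P W) ∧
    e = klDiv Q (jointPW P W) + max (R - fFun Q (jointPW P W)) 0 }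

/-- The partition function `∑ₐ p(a) exp(t g(a))`. -/
def tiltedMass {α : Type*} [Fintype α] (p g : α → ℝ) (t : ℝ) : ℝ :=
  ∑ a, p a * Real.exp (t * g a)

/-- The expectation of `g` under `Q`, as a sum over the support of `Q`. -/
def supportMean {α : Type*} [Fintype α] (Q g : α → ℝ) : ℝ :=
  ∑ a, if 0 < Q a then Q a * g a else 0

/-- The exponentially tilted pmf `Q(a) ∝ p(a) exp(t g(a))`. -/
def tiltedPMF {α : Type*} [Fintype α] (p g : α → ℝ) (t : ℝ) : α → ℝ :=
  fun a => p a * Real.exp (t * g a) / tiltedMass p g t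

section Tilting

variable {α : Type*} [Fintype α] {p : α → ℝ}

theorem IsPMF.tiltedMass_pos (hp : IsPMF p) (g : α → ℝ) (t : ℝ) : 0 < tiltedMass p g t := by
  refine Finset.sum_pos' (fun a _ => mul_nonneg (hp.1 a) (Real.exp_pos _).le) ?_
  by_contra! h
  have hle : ∑ a, p a ≤ 0 := Finset.sum_nonpos fun a ha =>
    nonpos_of_mul_nonpos_left (h a ha) (Real.exp_pos _)
  linarith [hp.2]

theorem IsPMF.supportMean_eq {Q : α → ℝ} (hQ : IsPMF Q) (g : α → ℝ) :
    supportMean Q g = ∑ a, Q a * g a := by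
  refine Finset.sum_congr rfl fun a _ => ?_
  split_ifs with h
  · rfl
  · simp [le_antisymm (not_lt.mp h) (hQ.1 a)]

theorem IsPMF.isPMF_tiltedPMF (hp : IsPMF p) (g : α → ℝ) (t : ℝ) :
    IsPMF (tiltedPMF p g t) := by
  have hZ := hp.tiltedMass_pos g t
  refine ⟨fun a => div_nonneg (mul_nonneg (hp.1 a) (Real.exp_pos _).le) hZ.le, ?_⟩
  unfold tiltedPMF
  rw [← Finset.sum_div]
  exact div_self hZ.ne'

theorem IsPMF.absCont_tiltedPMF (hp : IsPMF p) (g : α → ℝ) (t : ℝ) :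
    AbsCont (tiltedPMF p g t) p := by
  intro a ha
  refine (hp.1 a).lt_of_ne fun h => ?_
  simp [tiltedPMF, ← h] at ha

/-- Gibbs' variational inequality. -/
theorem IsPMF.neg_log_tiltedMass_le (hp : IsPMF p) {Q : α → ℝ} (hQ : IsPMF Q)
    (hQp : AbsCont Q p) (g : α → ℝ) (t : ℝ) :
    -Real.log (tiltedMass p g t) ≤ klDiv Q p - t * supportMean Q g := by
  have hZ := hp.tiltedMass_pos g t
  have hT := hp.isPMF_tiltedPMF g t
  have key : ∀ a, Q a - tiltedPMF p g t a ≤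
      (if 0 < Q a then Q a * Real.log (Q a / p a) else 0) - t * (Q a * g a)
        + Q a * Real.log (tiltedMass p g t) := by
    intro a
    split_ifs with h
    · have hpa := hQp a h
      have hTa : 0 < tiltedPMF p g t a := div_pos (mul_pos hpa (Real.exp_pos _)) hZ
      have h1 := Real.log_le_sub_one_of_pos (div_pos hTa h)
      have h2 : Real.log (tiltedPMF p g t a / Q a) =
          t * g a - Real.log (tiltedMass p g t) - Real.log (Q a / p a) := by
        rw [Real.log_div hTa.ne' h.ne', Real.log_div h.ne' hpa.ne', tiltedPMF,
          Real.log_div (mul_pos hpa (Real.exp_pos _)).ne' hZ.ne',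
          Real.log_mul hpa.ne' (Real.exp_pos _).ne', Real.log_exp]
        ring
      rw [h2] at h1
      have h3 := mul_le_mul_of_nonneg_left h1 h.le
      have h4 : Q a * (tiltedPMF p g t a / Q a - 1) = tiltedPMF p g t a - Q a := by
        field_simp
      linarith
    · have h0 : Q a = 0 := le_antisymm (not_lt.mp h) (hQ.1 a)
      simp [h0, hT.1 a]
  have hsum := Finset.sum_le_sum fun a (_ : a ∈ Finset.univ) => key a
  rw [Finset.sum_sub_distrib, Finset.sum_add_distrib, Finset.sum_sub_distrib,
    ← Finset.mul_sum, ← Finset.sum_mul, hQ.2, hT.2, ← hQ.supportMean_eq] at hsum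
  unfold klDiv
  linarith

/-- The tilted pmf attains equality in Gibbs' variational inequality. -/
theorem IsPMF.klDiv_tiltedPMF (hp : IsPMF p) (g : α → ℝ) (t : ℝ) :
    klDiv (tiltedPMF p g t) p =
      t * supportMean (tiltedPMF p g t) g - Real.log (tiltedMass p g t) := by
  have hZ := hp.tiltedMass_pos g t
  have hT := hp.isPMF_tiltedPMF g t
  have key : klDiv (tiltedPMF p g t) p = ∑ a, (t * (tiltedPMF p g t a * g a)
      - tiltedPMF p g t a * Real.log (tiltedMass p g t)) := by
    refine Finset.sum_congr rfl fun a _ => ?_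
    split_ifs with h
    · have hpa := hp.absCont_tiltedPMF g t a h
      have h2 : tiltedPMF p g t a / p a = Real.exp (t * g a) / tiltedMass p g t := by
        unfold tiltedPMF
        field_simp
      rw [h2, Real.log_div (Real.exp_pos _).ne' hZ.ne', Real.log_exp]
      ring
    · simp [le_antisymm (not_lt.mp h) (hT.1 a)]
  rw [key, Finset.sum_sub_distrib, ← Finset.mul_sum, ← Finset.sum_mul, hT.2,
    ← hT.supportMean_eq, one_mul]

theorem IsPMF.hasDerivAt_log_tiltedMass (hp : IsPMF p) (g : α → ℝ) (t : ℝ) :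
    HasDerivAt (fun s => Real.log (tiltedMass p g s)) (supportMean (tiltedPMF p g t) g) t := by
  have hd : HasDerivAt (tiltedMass p g) (∑ a, p a * (Real.exp (t * g a) * g a)) t := by
    unfold tiltedMass
    refine HasDerivAt.fun_sum fun a _ => ?_
    simpa using (((hasDerivAt_id t).mul_const (g a)).exp).const_mul (p a)
  convert hd.log (hp.tiltedMass_pos g t).ne' using 1
  rw [(hp.isPMF_tiltedPMF g t).supportMean_eq, Finset.sum_div]
  refine Finset.sum_congr rfl fun a _ => ?_
  unfold tiltedPMF
  ring

/-- Strong duality between the clipped divergence minimization and its Gallager form. -/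
theorem IsPMF.sInf_klDiv_add_max_eq (hp : IsPMF p) (g : α → ℝ) (R : ℝ) :
    sInf { e : ℝ | ∃ Q : α → ℝ, IsPMF Q ∧ AbsCont Q p ∧
        e = klDiv Q p + max (R - supportMean Q g) 0 }
      = sSup { e : ℝ | ∃ t : ℝ, 0 ≤ t ∧ t ≤ 1 ∧
        e = t * R - Real.log (tiltedMass p g t) } := by
  have hderiv : ∀ t, HasDerivAt (fun s => s * R - Real.log (tiltedMass p g s))
      (R - supportMean (tiltedPMF p g t) g) t := fun t => by
    simpa using ((hasDerivAt_id t).mul_const R).fun_sub (hp.hasDerivAt_log_tiltedMass g t)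
  obtain ⟨t, ht, hmax⟩ := isCompact_Icc.exists_isMaxOn (Set.nonempty_Icc.mpr zero_le_one)
    (fun t _ => (hderiv t).continuousAt.continuousWithinAt :
      ContinuousOn (fun s => s * R - Real.log (tiltedMass p g s)) (Set.Icc (0 : ℝ) 1))
  have first_order : ∀ s ∈ Set.Icc (0 : ℝ) 1,
      (s - t) * (R - supportMean (tiltedPMF p g t) g) ≤ 0 := fun s hs => by
    simpa using hmax.localize.hasFDerivWithinAt_nonpos (hderiv t).hasFDerivAt.hasFDerivWithinAt
      (sub_mem_posTangentConeAt_of_segment_subset ((convex_Icc (0 : ℝ) 1).segment_subset ht hs))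
  have h0 := first_order 0 (by simp)
  have h1 := first_order 1 (by simp)
  have hclip : max (R - supportMean (tiltedPMF p g t) g) 0
      = t * (R - supportMean (tiltedPMF p g t) g) := by
    generalize R - supportMean (tiltedPMF p g t) g = d at h0 h1
    rcases le_total d 0 with hd | hd
    · rw [max_eq_right hd]
      nlinarith [mul_nonneg ht.1 (neg_nonneg.mpr hd)]
    · rw [max_eq_left hd]
      nlinarith [mul_nonneg (sub_nonneg.mpr ht.2) hd]
  have hgreatest : IsGreatest { e : ℝ | ∃ t : ℝ, 0 ≤ t ∧ t ≤ 1 ∧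
      e = t * R - Real.log (tiltedMass p g t) } (t * R - Real.log (tiltedMass p g t)) := by
    refine ⟨⟨t, ht.1, ht.2, rfl⟩, ?_⟩
    rintro _ ⟨s, hs0, hs1, rfl⟩
    exact hmax ⟨hs0, hs1⟩
  have hleast : IsLeast { e : ℝ | ∃ Q : α → ℝ, IsPMF Q ∧ AbsCont Q p ∧
      e = klDiv Q p + max (R - supportMean Q g) 0 }
      (t * R - Real.log (tiltedMass p g t)) := by
    refine ⟨⟨tiltedPMF p g t, hp.isPMF_tiltedPMF g t, hp.absCont_tiltedPMF g t, ?_⟩, ?_⟩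
    · rw [hclip, hp.klDiv_tiltedPMF]
      ring
    · rintro _ ⟨Q, hQ, hQp, rfl⟩
      have hgibbs := hp.neg_log_tiltedMass_le hQ hQp g t
      have hle : t * (R - supportMean Q g) ≤ max (R - supportMean Q g) 0 := by
        rcases le_total (R - supportMean Q g) 0 with hd | hd
        · exact (mul_nonpos_of_nonneg_of_nonpos ht.1 hd).trans (le_max_right _ _)
        · exact (mul_le_of_le_one_left hd ht.2).trans (le_max_left _ _)
      linarith
  rw [hleast.csInf_eq, hgreatest.csSup_eq]

end Tilting

theorem margX_jointPW {𝒳 𝒵 : Type*} [Fintype 𝒵] {P : 𝒳 → ℝ} {W : 𝒳 → 𝒵 → ℝ}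
    (hW : IsChannel W) : margX (jointPW P W) = P := by
  funext x
  simp [margX, jointPW, ← Finset.mul_sum, (hW x).2]

section Channel

variable {𝒳 𝒵 : Type*} [Fintype 𝒳] [Fintype 𝒵] {P : 𝒳 → ℝ} {W : 𝒳 → 𝒵 → ℝ}

theorem isPMF_jointPW (hP : IsPMF P) (hW : IsChannel W) : IsPMF (jointPW P W) := by
  refine ⟨fun a => mul_nonneg (hP.1 _) ((hW _).1 _), ?_⟩
  rw [Fintype.sum_prod_type]
  exact (Finset.sum_congr rfl fun x _ => congrFun (margX_jointPW hW) x).trans hP.2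

theorem F0_eq_log_tiltedMass (hP : IsPMF P) (hW : IsChannel W) (t : ℝ) :
    F0 P W t = Real.log (tiltedMass (jointPW P W) (fun a => Real.log (jointPW P W a /
      (margX (jointPW P W) a.1 * margZ (jointPW P W) a.2))) t) := by
  unfold F0 tiltedMass
  congr 1
  refine Finset.sum_congr rfl fun a _ => ?_
  split_ifs with h
  · have hPa : 0 < P a.1 := pos_of_mul_pos_left h ((hW _).1 _)
    have hWa : 0 < W a.1 a.2 := pos_of_mul_pos_right h (hP.1 _)
    have hout : 0 < outDist P W a.2 := h.trans_le
      (Finset.single_le_sum (f := fun x => P x * W x a.2)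
        (fun x _ => mul_nonneg (hP.1 x) ((hW x).1 _)) (Finset.mem_univ a.1))
    have hratio : jointPW P W a / (margX (jointPW P W) a.1 * margZ (jointPW P W) a.2)
        = W a.1 a.2 / outDist P W a.2 := by
      rw [margX_jointPW hW]
      exact mul_div_mul_left _ _ hPa.ne'
    beta_reduce
    rw [hratio, mul_comm t, ← Real.rpow_def_of_pos (div_pos hWa hout),
      Real.div_rpow hWa.le hout.le, Real.rpow_add hWa, Real.rpow_one, Real.rpow_neg hout.le]
    unfold jointPW
    ring
  · have h0 : jointPW P W a = 0 :=
      le_antisymm (not_lt.mp h) (mul_nonneg (hP.1 _) ((hW _).1 _))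
    simp [h0]

end Channel

theorem iid_exponent_gallager_form
    {𝒳 𝒵 : Type*} [Fintype 𝒳] [Fintype 𝒵] [Nonempty 𝒳] [Nonempty 𝒵]
    (P_X : 𝒳 → ℝ) (W : 𝒳 → 𝒵 → ℝ) (hP : IsPMF P_X) (hW : IsChannel W) (R : ℝ) :
    EsIID P_X W R
      = sSup { e : ℝ | ∃ lam : ℝ, 0 ≤ lam ∧ lam ≤ 1 ∧ e = lam * R - F0 P_X W lam } := by
  simp_rw [F0_eq_log_tiltedMass hP hW]
  exact (isPMF_jointPW hP hW).sInf_klDiv_add_max_eq _ R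

end
end

section
/- Fix finite nonempty sets 𝒳, 𝒵, a pmf P_X on 𝒳, a channel W from 𝒳 to 𝒵, and λ ∈ [0,1]. Then the minimum over joint pmfs Q on 𝒳×𝒵 with Q ≪ P_X×W of { D(Q‖P_X×W) − λ f(Q‖P_X×W) } equals −F_0(P_X,W,λ), where F_0(P_X,W,λ) := ln Σ_{(x,z): P_X(x)W(z|x)>0} P_X(x) W(z|x)^{1+λ} (P_X∘W)(z)^{−λ}. Moreover the minimum is attained at the pmf Q proportional to P_X(x)W(z|x)^{1+λ}(P_X∘W)(z)^{−λ}. -/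
open Filter

noncomputable section

/-- The tilted distribution proportional to `P_X(x)W(z|x)^{1+λ}(P_X∘W)(z)^{−λ}`
(normalized by `exp(F₀(P_X,W,λ))`). -/
def Qstar {𝒳 𝒵 : Type*} [Fintype 𝒳] [Fintype 𝒵] (P : 𝒳 → ℝ) (W : 𝒳 → 𝒵 → ℝ) (lam : ℝ) :
    𝒳 × 𝒵 → ℝ :=
  fun p => (if 0 < P p.1 * W p.1 p.2 then
    P p.1 * (W p.1 p.2) ^ (1 + lam) * (outDist P W p.2) ^ (-lam) else 0) /
      Real.exp (F0 P W lam)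

theorem klDiv_self {α : Type*} [Fintype α] (Q : α → ℝ) : klDiv Q Q = 0 := by
  unfold klDiv
  refine Finset.sum_eq_zero fun a _ => ?_
  split_ifs with h
  · simp [div_self h.ne']
  · rfl

/-- Gibbs' inequality. -/
theorem klDiv_nonneg {α : Type*} [Fintype α] {Q R : α → ℝ} (hQ : IsPMF Q) (hR : IsPMF R)
    (h : AbsCont Q R) : 0 ≤ klDiv Q R := by
  have key : ∑ a, (Q a - R a) ≤ klDiv Q R := by
    refine Finset.sum_le_sum fun a _ => ?_
    split_ifs with ha
    · have hlog := Real.one_sub_inv_le_log_of_pos (div_pos ha (h a ha))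
      calc Q a - R a = Q a * (1 - (Q a / R a)⁻¹) := by
            rw [inv_div]
            field_simp
        _ ≤ _ := mul_le_mul_of_nonneg_left hlog ha.le
    · linarith [hR.1 a]
  rwa [Finset.sum_sub_distrib, hQ.2, hR.2, sub_self] at key

section Tilted

variable {𝒳 𝒵 : Type*} [Fintype 𝒳] [Fintype 𝒵] {P : 𝒳 → ℝ} {W : 𝒳 → 𝒵 → ℝ}

theorem pos_of_jointPW_pos (hP : IsPMF P) (hW : IsChannel W) {p : 𝒳 × 𝒵}
    (h : 0 < jointPW P W p) : 0 < P p.1 ∧ 0 < W p.1 p.2 ∧ 0 < outDist P W p.2 := by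
  refine ⟨pos_of_mul_pos_left h ((hW p.1).1 p.2), pos_of_mul_pos_right h (hP.1 p.1),
    h.trans_le ?_⟩
  exact Finset.single_le_sum (f := fun x => P x * W x p.2)
    (fun x _ => mul_nonneg (hP.1 x) ((hW x).1 p.2)) (Finset.mem_univ p.1)

theorem sum_jointPW (hP : IsPMF P) (hW : IsChannel W) : ∑ p, jointPW P W p = 1 := by
  rw [Fintype.sum_prod_type, ← hP.2]
  exact Finset.sum_congr rfl fun x _ => congrFun (margX_jointPW hW) x

theorem tilted_pos (hP : IsPMF P) (hW : IsChannel W) (lam : ℝ) {p : 𝒳 × 𝒵}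
    (h : 0 < jointPW P W p) :
    0 < P p.1 * (W p.1 p.2) ^ (1 + lam) * (outDist P W p.2) ^ (-lam) := by
  obtain ⟨h₁, h₂, h₃⟩ := pos_of_jointPW_pos hP hW h
  positivity

theorem tilted_nonneg (hP : IsPMF P) (hW : IsChannel W) (lam : ℝ) (p : 𝒳 × 𝒵) :
    0 ≤ (if 0 < P p.1 * W p.1 p.2 then
      P p.1 * (W p.1 p.2) ^ (1 + lam) * (outDist P W p.2) ^ (-lam) else 0) := by
  split_ifs with h
  · exact (tilted_pos hP hW lam h).le
  · exact le_rfl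

theorem exp_F0 (hP : IsPMF P) (hW : IsChannel W) (lam : ℝ) :
    Real.exp (F0 P W lam) = ∑ p : 𝒳 × 𝒵, if 0 < P p.1 * W p.1 p.2 then
      P p.1 * (W p.1 p.2) ^ (1 + lam) * (outDist P W p.2) ^ (-lam) else 0 := by
  refine Real.exp_log ?_
  obtain ⟨p, -, hp⟩ : ∃ p ∈ Finset.univ, 0 < jointPW P W p := by
    refine Finset.exists_lt_of_sum_lt ?_
    simp [sum_jointPW hP hW]
  refine Finset.sum_pos' (fun p _ => tilted_nonneg hP hW lam p) ⟨p, Finset.mem_univ p, ?_⟩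
  rw [if_pos (show 0 < P p.1 * W p.1 p.2 from hp)]
  exact tilted_pos hP hW lam hp

theorem isPMF_Qstar (hP : IsPMF P) (hW : IsChannel W) (lam : ℝ) : IsPMF (Qstar P W lam) := by
  refine ⟨fun p => div_nonneg (tilted_nonneg hP hW lam p) (Real.exp_pos _).le, ?_⟩
  simp only [Qstar]
  rw [← Finset.sum_div, ← exp_F0 hP hW, div_self (Real.exp_ne_zero _)]

theorem Qstar_pos_iff (hP : IsPMF P) (hW : IsChannel W) (lam : ℝ) (p : 𝒳 × 𝒵) :
    0 < Qstar P W lam p ↔ 0 < jointPW P W p := by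
  unfold Qstar
  refine ⟨fun h => ?_, fun h => ?_⟩
  · by_contra hn
    rw [if_neg (show ¬0 < P p.1 * W p.1 p.2 from hn), zero_div] at h
    exact lt_irrefl _ h
  · rw [if_pos (show 0 < P p.1 * W p.1 p.2 from h)]
    exact div_pos (tilted_pos hP hW lam h) (Real.exp_pos _)

theorem log_Qstar (hP : IsPMF P) (hW : IsChannel W) (lam : ℝ) {p : 𝒳 × 𝒵}
    (h : 0 < jointPW P W p) :
    Real.log (Qstar P W lam p) = Real.log (P p.1) + (1 + lam) * Real.log (W p.1 p.2)
      - lam * Real.log (outDist P W p.2) - F0 P W lam := by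
  obtain ⟨h₁, h₂, h₃⟩ := pos_of_jointPW_pos hP hW h
  unfold Qstar
  rw [if_pos (show 0 < P p.1 * W p.1 p.2 from h),
    Real.log_div (tilted_pos hP hW lam h).ne' (Real.exp_ne_zero _), Real.log_exp,
    Real.log_mul (by positivity) (by positivity), Real.log_mul (by positivity) (by positivity),
    Real.log_rpow h₂, Real.log_rpow h₃]
  ring

/-- The objective is, up to the constant `F₀`, the divergence from the tilted distribution. -/
theorem klDiv_sub_mul_fFun (hP : IsPMF P) (hW : IsChannel W) (lam : ℝ) {Q : 𝒳 × 𝒵 → ℝ}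
    (hQ : IsPMF Q) (hQP : AbsCont Q (jointPW P W)) :
    klDiv Q (jointPW P W) - lam * fFun Q (jointPW P W)
      = klDiv Q (Qstar P W lam) - F0 P W lam := by
  have hF : F0 P W lam = ∑ p, Q p * F0 P W lam := by
    rw [← Finset.sum_mul, hQ.2, one_mul]
  rw [hF]
  unfold klDiv fFun
  rw [Finset.mul_sum, ← Finset.sum_sub_distrib, ← Finset.sum_sub_distrib]
  refine Finset.sum_congr rfl fun p _ => ?_
  split_ifs with hp
  · have hj := hQP p hp
    obtain ⟨h₁, h₂, h₃⟩ := pos_of_jointPW_pos hP hW hj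
    have hlogj : Real.log (jointPW P W p) = Real.log (P p.1) + Real.log (W p.1 p.2) :=
      Real.log_mul h₁.ne' h₂.ne'
    have hmargZ : margZ (jointPW P W) = outDist P W := rfl
    rw [margX_jointPW hW, hmargZ, Real.log_div hp.ne' hj.ne',
      Real.log_div hj.ne' (mul_pos h₁ h₃).ne', Real.log_mul h₁.ne' h₃.ne',
      Real.log_div hp.ne' ((Qstar_pos_iff hP hW lam p).2 hj).ne', log_Qstar hP hW lam hj, hlogj]
    ring
  · rw [le_antisymm (not_lt.1 hp) (hQ.1 p)]
    simp

end Tilted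

theorem min_div_minus_lam_f_eq_neg_F0
    {𝒳 𝒵 : Type*} [Fintype 𝒳] [Fintype 𝒵] [Nonempty 𝒳] [Nonempty 𝒵]
    (P_X : 𝒳 → ℝ) (W : 𝒳 → 𝒵 → ℝ) (hP : IsPMF P_X) (hW : IsChannel W)
    (lam : ℝ) (hlam0 : 0 ≤ lam) (hlam1 : lam ≤ 1) :
    sInf { e : ℝ | ∃ Q : 𝒳 × 𝒵 → ℝ, IsPMF Q ∧ AbsCont Q (jointPW P_X W) ∧
        e = klDiv Q (jointPW P_X W) - lam * fFun Q (jointPW P_X W) }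
      = -F0 P_X W lam
    ∧ IsPMF (Qstar P_X W lam)
    ∧ AbsCont (Qstar P_X W lam) (jointPW P_X W)
    ∧ klDiv (Qstar P_X W lam) (jointPW P_X W)
        - lam * fFun (Qstar P_X W lam) (jointPW P_X W) = -F0 P_X W lam := by
  have hpmf := isPMF_Qstar hP hW lam
  have hac : AbsCont (Qstar P_X W lam) (jointPW P_X W) :=
    fun p hp => (Qstar_pos_iff hP hW lam p).1 hp
  have hval : klDiv (Qstar P_X W lam) (jointPW P_X W)
      - lam * fFun (Qstar P_X W lam) (jointPW P_X W) = -F0 P_X W lam := by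
    rw [klDiv_sub_mul_fFun hP hW lam hpmf hac, klDiv_self, zero_sub]
  refine ⟨IsLeast.csInf_eq ⟨⟨_, hpmf, hac, hval.symm⟩, ?_⟩, hpmf, hac, hval⟩
  rintro e ⟨Q, hQ, hQP, rfl⟩
  rw [klDiv_sub_mul_fFun hP hW lam hQ hQP]
  have := klDiv_nonneg hQ hpmf fun p hp => (Qstar_pos_iff hP hW lam p).2 (hQP p hp)
  linarith

end
end
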